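/- Let M ≥ δ > 0. Then there exist constants C > 0 and ε₀ > 0 such that for all vectors a, b in the Euclidean plane with ‖a‖ ≤ M and δ ≤ ‖b‖ ≤ M, and for all ε with 0 < ε ≤ ε₀, one has ‖(a + ε⁻¹ b)/‖a + ε⁻¹ b‖ − b/‖b‖ − ε ν₁(a,b)‖ ≤ C ε², where ν₁(a,b) := a/‖b‖ − (⟪a,b⟫/‖b‖²)·(b/‖b‖). -/

import Mathlib

open scoped RealInnerProductSpace

/-- Uniform version of the expansion `ν^ε = ν₀ + ε ν₁ + O(ε²)` of the unit normal,
with constants uniform over `‖a‖ ≤ M` and `δ ≤ ‖b‖ ≤ M`. -/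
theorem unit_normal_expansion_uniform (M δ : ℝ) (hδ : 0 < δ) (hM : δ ≤ M) :
    ∃ C > (0 : ℝ), ∃ ε₀ > (0 : ℝ),
      ∀ a b : EuclideanSpace ℝ (Fin 2), ‖a‖ ≤ M → δ ≤ ‖b‖ → ‖b‖ ≤ M →
        ∀ ε : ℝ, 0 < ε → ε ≤ ε₀ →
          ‖‖a + ε⁻¹ • b‖⁻¹ • (a + ε⁻¹ • b) - ‖b‖⁻¹ • b -
              ε • (‖b‖⁻¹ • a - (⟪a, b⟫ / ‖b‖ ^ 2) • (‖b‖⁻¹ • b))‖ ≤ C * ε ^ 2 := by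
  have hMp : 0 < M := lt_of_lt_of_le hδ hM
  refine ⟨(M ^ 2 / (δ ^ 2 * (δ / 2)) + M ^ 2 / (2 * δ ^ 3)) * M + M / (δ * (δ / 2)) * M,
    by positivity, δ / (2 * M), by positivity, ?_⟩
  intro a b ha hb hbM ε hε hεle
  have hεM : ε * M ≤ δ / 2 := by
    rw [le_div_iff₀ (by positivity)] at hεle
    linarith
  obtain ⟨v, hv⟩ : ∃ v, v = b + ε • a := ⟨_, rfl⟩
  have hav : a + ε⁻¹ • b = ε⁻¹ • v := by
    rw [hv, smul_add, smul_smul, inv_mul_cancel₀ hε.ne', one_smul, add_comm]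
  have hnorm : ‖ε⁻¹ • v‖⁻¹ • (ε⁻¹ • v) = ‖v‖⁻¹ • v := by
    rw [norm_smul, smul_smul, Real.norm_of_nonneg (by positivity)]
    congr 1
    rw [mul_inv, inv_inv]
    field_simp
  have hsq : ‖v‖ ^ 2 = ‖b‖ ^ 2 + 2 * ε * ⟪a, b⟫ + ε ^ 2 * ‖a‖ ^ 2 := by
    rw [hv, norm_add_sq_real, inner_smul_right, norm_smul, Real.norm_of_nonneg hε.le,
      real_inner_comm]
    ring
  have hd : |‖v‖ - ‖b‖| ≤ ε * ‖a‖ := by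
    have := abs_norm_sub_norm_le v b
    rwa [hv, add_sub_cancel_left, norm_smul, Real.norm_of_nonneg hε.le, ← hv] at this
  have hA : 0 ≤ ‖a‖ := norm_nonneg a
  have hdM : |‖v‖ - ‖b‖| ≤ ε * M := hd.trans (by gcongr)
  have hn0 : 0 < ‖b‖ := hδ.trans_le hb
  have hN : δ / 2 ≤ ‖v‖ := by
    have := (abs_le.1 hdM).1
    linarith
  have hN0 : 0 < ‖v‖ := by linarith
  rw [hav, hnorm]
  have key : ‖v‖⁻¹ • v - ‖b‖⁻¹ • b - ε • (‖b‖⁻¹ • a - (⟪a, b⟫ / ‖b‖ ^ 2) • (‖b‖⁻¹ • b))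
      = (‖v‖⁻¹ - ‖b‖⁻¹ + ε * ⟪a, b⟫ / ‖b‖ ^ 3) • b + (ε * (‖v‖⁻¹ - ‖b‖⁻¹)) • a := by
    have h3 : ε * ⟪a, b⟫ / ‖b‖ ^ 3 = ε * (⟪a, b⟫ / ‖b‖ ^ 2 * ‖b‖⁻¹) := by field_simp
    rw [h3]
    generalize ‖v‖⁻¹ = p
    rw [hv]
    module
  rw [key]
  generalize ⟪a, b⟫ = s at *
  have hb' := norm_nonneg b
  obtain ⟨d, hdd⟩ : ∃ d, d = ‖v‖ - ‖b‖ := ⟨_, rfl⟩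
  rw [← hdd] at hd hdM
  have hd2 : d ^ 2 ≤ ε ^ 2 * ‖a‖ ^ 2 := by
    rw [← mul_pow, ← sq_abs d]; gcongr
  have hA2 : ε ^ 2 * ‖a‖ ^ 2 ≤ ε ^ 2 * M ^ 2 := by gcongr
  have e1 : ‖v‖⁻¹ - ‖b‖⁻¹ + ε * s / ‖b‖ ^ 3
      = d ^ 2 / (‖b‖ ^ 2 * ‖v‖) - (ε ^ 2 * ‖a‖ ^ 2 - d ^ 2) / (2 * ‖b‖ ^ 3) := by
    have h4 : ε * s = (‖v‖ ^ 2 - ‖b‖ ^ 2 - ε ^ 2 * ‖a‖ ^ 2) / 2 := by linarith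
    rw [h4, hdd]
    field_simp
    ring
  have b1 : |‖v‖⁻¹ - ‖b‖⁻¹ + ε * s / ‖b‖ ^ 3|
      ≤ (M ^ 2 / (δ ^ 2 * (δ / 2)) + M ^ 2 / (2 * δ ^ 3)) * ε ^ 2 := by
    rw [e1]
    have p1 : d ^ 2 / (‖b‖ ^ 2 * ‖v‖) ≤ (ε ^ 2 * M ^ 2) / (δ ^ 2 * (δ / 2)) := by
      gcongr; linarith
    have p2 : (ε ^ 2 * ‖a‖ ^ 2 - d ^ 2) / (2 * ‖b‖ ^ 3) ≤ (ε ^ 2 * M ^ 2) / (2 * δ ^ 3) := by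
      gcongr; nlinarith [sq_nonneg d]
    have q1 : 0 ≤ d ^ 2 / (‖b‖ ^ 2 * ‖v‖) := by positivity
    have q2 : 0 ≤ (ε ^ 2 * ‖a‖ ^ 2 - d ^ 2) / (2 * ‖b‖ ^ 3) :=
      div_nonneg (by linarith) (by positivity)
    have r : (M ^ 2 / (δ ^ 2 * (δ / 2)) + M ^ 2 / (2 * δ ^ 3)) * ε ^ 2
      = (ε ^ 2 * M ^ 2) / (δ ^ 2 * (δ / 2)) + (ε ^ 2 * M ^ 2) / (2 * δ ^ 3) := by ring
    rw [r, abs_le]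
    constructor <;> linarith
  have b2 : |‖v‖⁻¹ - ‖b‖⁻¹| ≤ ε * M / (δ * (δ / 2)) := by
    have e2 : ‖v‖⁻¹ - ‖b‖⁻¹ = -d / (‖b‖ * ‖v‖) := by
      rw [hdd]; field_simp; ring
    rw [e2, abs_div, abs_neg, abs_of_pos (mul_pos hn0 hN0)]
    gcongr
  calc _ ≤ |‖v‖⁻¹ - ‖b‖⁻¹ + ε * s / ‖b‖ ^ 3| * ‖b‖ + ε * |‖v‖⁻¹ - ‖b‖⁻¹| * ‖a‖ := by
        refine (norm_add_le _ _).trans (le_of_eq ?_)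
        rw [norm_smul, norm_smul, Real.norm_eq_abs, Real.norm_eq_abs, abs_mul, abs_of_pos hε]
    _ ≤ ((M ^ 2 / (δ ^ 2 * (δ / 2)) + M ^ 2 / (2 * δ ^ 3)) * ε ^ 2) * M
        + ε * (ε * M / (δ * (δ / 2))) * M := by gcongr
    _ = _ := by ring
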